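/- arXiv:1910.07913 — 9 statements merged into one kernel-verified Lean document; each statement's English description precedes it below -/
import Mathlib

section
/- Let C ⊆ [0,1] be a separably closed set, i.e. C is the closure in ℝ of the range of a sequence x : ℕ → ℝ with x n ∈ [0,1] for all n, and let M ≥ 0. If f : ℝ → ℝ is continuous on C and satisfies |f x| ≤ M for all x ∈ C, then there exists g : ℝ → ℝ continuous on [0,1] with g x = f x for every x ∈ C and |g y| ≤ M for every y ∈ [0,1]. -/
/-- Bound-preserving Tietze extension theorem for separably closed subsets of `[0,1]`. -/
theorem tietze_sep_closed_bounded (C : Set ℝ) (x : ℕ → ℝ)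
    (hx : ∀ n, x n ∈ Set.Icc (0:ℝ) 1) (hC : C = closure (Set.range x))
    (M : ℝ) (hM : 0 ≤ M) (f : ℝ → ℝ) (hf : ContinuousOn f C)
    (hfM : ∀ y ∈ C, |f y| ≤ M) :
    ∃ g : ℝ → ℝ, ContinuousOn g (Set.Icc (0:ℝ) 1) ∧
      (∀ y ∈ C, g y = f y) ∧ ∀ y ∈ Set.Icc (0:ℝ) 1, |g y| ≤ M := by
  have hclosed : IsClosed C := hC ▸ isClosed_closure
  obtain ⟨g, hgM, hgf⟩ := ContinuousMap.exists_restrict_eq_forall_mem_of_closed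
    (⟨C.domRestrict f, hf.domRestrict⟩ : C(C, ℝ)) (t := Set.Icc (-M) M)
    (fun y => abs_le.mp (hfM y y.2)) ⟨0, by simpa using hM⟩ hclosed
  exact ⟨g, g.continuous.continuousOn, fun y hy => DFunLike.congr_fun hgf ⟨y, hy⟩,
    fun y _ => abs_le.mpr (hgM y)⟩
end

section
/- Let C ⊆ [0,1] be a separably closed set, i.e. C is the closure in ℝ of the range of a sequence x : ℕ → ℝ with x n ∈ [0,1] for all n. If f : ℝ → ℝ is continuous on C, then f has a modulus of uniform continuity on C: there exists h : ℕ → ℕ such that for every k ∈ ℕ and all x, y ∈ C, |x − y| < (1/2)^(h k) implies |f x − f y| < (1/2)^k. -/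
/-- Heine's theorem `HEI^ω` with a modulus of uniform continuity: a continuous
function on a separably closed `C ⊆ [0,1]` has a modulus `h : ℕ → ℕ`. -/
theorem heine_sep_closed_modulus (C : Set ℝ) (x : ℕ → ℝ)
    (hx : ∀ n, x n ∈ Set.Icc (0:ℝ) 1) (hC : C = closure (Set.range x))
    (f : ℝ → ℝ) (hf : ContinuousOn f C) :
    ∃ h : ℕ → ℕ, ∀ k : ℕ, ∀ a ∈ C, ∀ b ∈ C,
      |a - b| < (1/2 : ℝ) ^ (h k) → |f a - f b| < (1/2 : ℝ) ^ k := by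
  have hcompact : IsCompact C := by
    rw [hC]
    exact isCompact_Icc.closure_of_subset (Set.range_subset_iff.mpr hx)
  have huc := Metric.uniformContinuousOn_iff.mp (hcompact.uniformContinuousOn_of_continuous hf)
  have hmod : ∀ k : ℕ, ∃ m : ℕ, ∀ a ∈ C, ∀ b ∈ C,
      |a - b| < (1/2 : ℝ) ^ m → |f a - f b| < (1/2 : ℝ) ^ k := by
    intro k
    obtain ⟨δ, hδ, hfδ⟩ := huc ((1/2 : ℝ) ^ k) (by positivity)
    obtain ⟨m, hm⟩ := exists_pow_lt_of_lt_one hδ (by norm_num : (1/2 : ℝ) < 1)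
    exact ⟨m, fun a ha b hb hab => hfδ a ha b hb (hab.trans hm)⟩
  exact ⟨fun k => (hmod k).choose, fun k => (hmod k).choose_spec⟩
end

section
/- Let C ⊆ [0,1] be a separably closed set, i.e. C is the closure in ℝ of the range of a sequence x : ℕ → ℝ with x n ∈ [0,1] for all n. If f : ℝ → ℝ is continuous on C, then there exists a sequence of real polynomials p : ℕ → ℝ[X] such that for every n ∈ ℕ and every x ∈ C, |f x − (p n).eval x| < (1/2)^n. -/
/-- A real function continuous on a compact set is uniformly approximated there by polynomials. -/
theorem IsCompact.exists_polynomial_near {K : Set ℝ} (hK : IsCompact K) {f : ℝ → ℝ}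
    (hf : ContinuousOn f K) {ε : ℝ} (hε : 0 < ε) :
    ∃ p : Polynomial ℝ, ∀ y ∈ K, |f y - p.eval y| < ε := by
  have : CompactSpace K := isCompact_iff_compactSpace.mp hK
  let g : C(K, ℝ) := ⟨fun y => f y, continuousOn_iff_continuous_domRestrict.mp hf⟩
  have hg : g ∈ closure (polynomialFunctions K : Set C(K, ℝ)) := by
    rw [← Subalgebra.topologicalClosure_coe, polynomialFunctions.topologicalClosure]
    trivial
  obtain ⟨-, ⟨p, -, rfl⟩, hp⟩ := Metric.mem_closure_iff.mp hg ε hε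
  exact ⟨p, fun y hy => (ContinuousMap.dist_apply_le_dist ⟨y, hy⟩).trans_lt hp⟩

/-- Weierstrass' approximation theorem for separably closed sets, for
third-order functions (principle `WEI^ω`). -/
theorem weierstrass_sep_closed (C : Set ℝ) (x : ℕ → ℝ)
    (hx : ∀ n, x n ∈ Set.Icc (0:ℝ) 1) (hC : C = closure (Set.range x))
    (f : ℝ → ℝ) (hf : ContinuousOn f C) :
    ∃ p : ℕ → Polynomial ℝ, ∀ n : ℕ, ∀ y ∈ C,
      |f y - (p n).eval y| < (1/2 : ℝ) ^ n := by
  have hK : IsCompact C :=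
    hC ▸ isCompact_Icc.closure_of_subset (Set.range_subset_iff.mpr hx)
  choose p hp using fun n : ℕ =>
    hK.exists_polynomial_near hf (ε := (1/2 : ℝ) ^ n) (by positivity)
  exact ⟨p, hp⟩
end

section
/- Let f : ℝ → ℝ be continuous on the open interval (0,1) and suppose f(x) tends to 0 as x tends to 0 from the right (i.e. f converges to 0 along the filter of neighborhoods of 0 within (0,∞)). Define f̃ : ℝ → ℝ by f̃ x = 0 if x = 0 and f̃ x = f x otherwise. Then f̃ 0 = 0, f̃ x = f x for all x ∈ (0,1), and f̃ is continuous on the half-open interval [0,1). -/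
open Filter Topology

/-- One-point-extension theorem for third-order functions (Theorem `KAYO2`). -/
theorem one_point_extension (f : ℝ → ℝ) (hf : ContinuousOn f (Set.Ioo (0:ℝ) 1))
    (hlim : Tendsto f (nhdsWithin 0 (Set.Ioi (0:ℝ))) (nhds 0)) :
    (fun y : ℝ => if y = 0 then (0:ℝ) else f y) 0 = 0 ∧
    (∀ y ∈ Set.Ioo (0:ℝ) 1, (fun y : ℝ => if y = 0 then (0:ℝ) else f y) y = f y) ∧
    ContinuousOn (fun y : ℝ => if y = 0 then (0:ℝ) else f y) (Set.Ico (0:ℝ) 1) := by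
  refine ⟨if_pos rfl, fun y hy => if_neg hy.1.ne', ?_⟩
  have h_update : (fun y : ℝ => if y = 0 then (0:ℝ) else f y) = Function.update f 0 0 := by
    ext y
    simp [Function.update_apply]
  rw [h_update, continuousOn_update_iff, Set.Ico_sdiff_left]
  exact ⟨hf, fun _ => hlim.mono_left (nhdsWithin_mono _ Set.Ioo_subset_Ioi_self)⟩
end

section
/- Equip Cantor space ℕ → Bool with the metric d(x,y) = (1/2)^n where n is the least index with x n ≠ y n (and d(x,y) = 0 if x = y). Let f : (ℕ → Bool) → ℝ be continuous and let ε > 0. Then there exists x* : ℕ → Bool such that for every y ≠ x*, f x* < f y + ε · d(x*, y). -/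
open Classical

/-- The standard metric on Cantor space: `d(x,y) = (1/2)^n` where `n` is the
least index with `x n ≠ y n`, and `d(x,y) = 0` if `x = y`. -/
noncomputable def cantorDist (x y : ℕ → Bool) : ℝ :=
  if h : x = y then 0 else (1/2 : ℝ) ^ Nat.find (Function.ne_iff.mp h)

/-- Ekeland's variational principle for total continuous potentials on `2^ℕ`. -/
theorem ekeland_cantor_continuous (f : (ℕ → Bool) → ℝ) (hf : Continuous f)
    (ε : ℝ) (hε : 0 < ε) :
    ∃ x : ℕ → Bool, ∀ y : ℕ → Bool, y ≠ x → f x < f y + ε * cantorDist x y := by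
  obtain ⟨x, -, hx⟩ := isCompact_univ.exists_isMinOn Set.univ_nonempty hf.continuousOn
  refine ⟨x, fun y hy => ?_⟩
  have hle : f x ≤ f y := hx (Set.mem_univ y)
  have hd : 0 < cantorDist x y := by
    rw [cantorDist, dif_neg hy.symm]
    positivity
  linarith [mul_pos hε hd]
end

section
/- Equip Cantor space ℕ → Bool with the metric d(x,y) = (1/2)^n where n is the least index with x n ≠ y n (and d(x,y) = 0 if x = y). Let f : (ℕ → Bool) → ℝ be lower semicontinuous and let ε > 0. Then there exists x* : ℕ → Bool such that for every y ≠ x*, f x* < f y + ε · d(x*, y). -/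
open Classical

/-- Distinct points of Cantor space are at positive distance. -/
theorem cantorDist_pos {x y : ℕ → Bool} (h : x ≠ y) : 0 < cantorDist x y := by
  rw [cantorDist, dif_neg h]
  positivity

/-- Ekeland's variational principle for total (lower semicontinuous) potentials on `2^ℕ`. -/
theorem ekeland_cantor_lsc (f : (ℕ → Bool) → ℝ) (hf : LowerSemicontinuous f)
    (ε : ℝ) (hε : 0 < ε) :
    ∃ x : ℕ → Bool, ∀ y : ℕ → Bool, y ≠ x → f x < f y + ε * cantorDist x y := by
  obtain ⟨x, -, hx⟩ := LowerSemicontinuousOn.exists_isMinOn Set.univ_nonempty isCompact_univ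
    (hf.lowerSemicontinuousOn Set.univ)
  refine ⟨x, fun y hy => ?_⟩
  have hxy : f x ≤ f y := hx (Set.mem_univ y)
  linarith [mul_pos hε (cantorDist_pos hy.symm)]
end

section
/- Equip Baire space ℕ → ℕ with the metric d(x,y) = (1/2)^n where n is the least index with x n ≠ y n (and d(x,y) = 0 if x = y). Let f : (ℕ → ℕ) → ℝ be continuous with range bounded below, and let ε > 0. Then there exists x* : ℕ → ℕ such that for every y ≠ x*, f x* < f y + ε · d(x*, y). -/
open Classical

/-- The standard metric on Baire space: `d(x,y) = (1/2)^n` where `n` is the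
least index with `x n ≠ y n`, and `d(x,y) = 0` if `x = y`. -/
noncomputable def baireDist (x y : ℕ → ℕ) : ℝ :=
  if h : x = y then 0 else (1/2 : ℝ) ^ Nat.find (Function.ne_iff.mp h)

/-- Ekeland's variational principle on a complete metric space. -/
theorem LowerSemicontinuous.exists_forall_lt_add_mul_dist {X : Type*} [MetricSpace X]
    [CompleteSpace X] [Nonempty X] {f : X → ℝ} (hf : LowerSemicontinuous f)
    (hbd : BddBelow (Set.range f)) {ε : ℝ} (hε : 0 < ε) :
    ∃ x, ∀ y, y ≠ x → f x < f y + ε * dist x y := by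
  let S : X → Set X := fun x => {y | f y + ε * dist x y ≤ f x}
  have self_mem : ∀ x, x ∈ S x := fun x => by simp [S]
  have S_trans : ∀ {x y z}, y ∈ S x → z ∈ S y → z ∈ S x := by
    intro x y z hy hz
    simp only [S, Set.mem_ofPred_eq] at *
    nlinarith [dist_triangle x y z]
  have S_closed : ∀ x, IsClosed (S x) := fun x =>
    (hf.add (by fun_prop : Continuous fun y => ε * dist x y).lowerSemicontinuous).isClosed_preimage
      (f x)
  have step : ∀ (n : ℕ) (x : X), ∃ y ∈ S x, ∀ z ∈ S x, f y < f z + (1 / 2 : ℝ) ^ n := by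
    intro n x
    have hne : (f '' S x).Nonempty := ⟨_, x, self_mem x, rfl⟩
    obtain ⟨_, ⟨y, hy, rfl⟩, hlt⟩ :=
      exists_lt_of_csInf_lt hne (lt_add_of_pos_right _ (by positivity : (0 : ℝ) < (1 / 2) ^ n))
    refine ⟨y, hy, fun z hz => hlt.trans_le ?_⟩
    gcongr
    exact csInf_le (hbd.mono (Set.image_subset_range _ _)) ⟨z, hz, rfl⟩
  choose next next_mem next_lt using step
  let u : ℕ → X := fun n => Nat.rec (Classical.arbitrary X) next n
  have u_mem : ∀ {n m}, n ≤ m → u m ∈ S (u n) := by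
    intro n m h
    induction h with
    | refl => exact self_mem _
    | step _ ih => exact S_trans ih (next_mem _ _)
  have dist_le : ∀ n, ∀ y ∈ S (u (n + 1)), dist y (u (n + 1)) ≤ (1 / 2 : ℝ) ^ n / ε := by
    intro n y hy
    have hlt : f (u (n + 1)) < f y + (1 / 2 : ℝ) ^ n :=
      next_lt n (u n) y (S_trans (next_mem n (u n)) hy)
    have hle : f y + ε * dist (u (n + 1)) y ≤ f (u (n + 1)) := hy
    rw [le_div_iff₀ hε, dist_comm]
    linarith
  have lim_zero : Filter.Tendsto (fun n : ℕ => (1 / 2 : ℝ) ^ n / ε) Filter.atTop (nhds 0) := by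
    simpa using (tendsto_pow_atTop_nhds_zero_of_lt_one (by norm_num : (0 : ℝ) ≤ 1 / 2)
      (by norm_num)).div_const ε
  have tendsto_of_mem : ∀ y, (∀ n, y ∈ S (u n)) →
      Filter.Tendsto (fun n => u (n + 1)) Filter.atTop (nhds y) := fun y hy =>
    tendsto_iff_dist_tendsto_zero.2 <| squeeze_zero (fun _ => dist_nonneg)
      (fun n => by rw [dist_comm]; exact dist_le n y (hy (n + 1))) lim_zero
  have u_cauchy : CauchySeq fun n => u (n + 1) :=
    cauchySeq_of_le_tendsto_0' _
      (fun n m h => by rw [dist_comm]; exact dist_le n _ (u_mem (Nat.succ_le_succ h))) lim_zero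
  obtain ⟨x, hx⟩ := cauchySeq_tendsto_of_complete u_cauchy
  have x_mem : ∀ n, x ∈ S (u n) := fun n =>
    (S_closed _).mem_of_tendsto hx <| by
      filter_upwards [Filter.eventually_ge_atTop n] with m hm using u_mem (Nat.le_succ_of_le hm)
  refine ⟨x, fun y hne => lt_of_not_ge fun hy => hne ?_⟩
  exact tendsto_nhds_unique (tendsto_of_mem y fun n => S_trans (x_mem n) hy) hx

theorem baireDist_eq_dist (x y : ℕ → ℕ) :
    baireDist x y = PiNat.metricSpaceNatNat.dist x y := by
  change _ = PiNat.dist.dist x y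
  by_cases h : x = y
  · simp [baireDist, h, PiNat.dist_self]
  · rw [PiNat.dist_eq_of_ne h, baireDist, dif_neg h, PiNat.firstDiff_def, dif_pos h]
    congr!

/-- Ekeland's variational principle for total continuous potentials on `ℕ^ℕ`
that are bounded below. -/
theorem ekeland_baire_continuous (f : (ℕ → ℕ) → ℝ) (hf : Continuous f)
    (hbd : BddBelow (Set.range f)) (ε : ℝ) (hε : 0 < ε) :
    ∃ x : ℕ → ℕ, ∀ y : ℕ → ℕ, y ≠ x → f x < f y + ε * baireDist x y := by
  simp only [baireDist_eq_dist]
  let := PiNat.metricSpaceNatNat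
  have : CompleteSpace (ℕ → ℕ) := Pi.complete _
  exact hf.lowerSemicontinuous.exists_forall_lt_add_mul_dist hbd hε
end

section
/- Let f : ℝ → ℝ be lower semicontinuous on [0,1] and let ε > 0. Then there exists x* ∈ [0,1] such that for every y ∈ [0,1] with y ≠ x*, f x* < f y + ε · |x* − y|. -/
/-- Ekeland's weak variational principle for total (lower semicontinuous)
potentials on the unit interval. -/
theorem ekeland_unit_interval_lsc (f : ℝ → ℝ)
    (hf : LowerSemicontinuousOn f (Set.Icc (0:ℝ) 1)) (ε : ℝ) (hε : 0 < ε) :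
    ∃ x ∈ Set.Icc (0:ℝ) 1, ∀ y ∈ Set.Icc (0:ℝ) 1, y ≠ x →
      f x < f y + ε * |x - y| := by
  obtain ⟨x, hx, hmin⟩ := LowerSemicontinuousOn.exists_isMinOn
    (Set.nonempty_Icc.2 zero_le_one) isCompact_Icc hf
  refine ⟨x, hx, fun y hy hyx => ?_⟩
  have hle : f x ≤ f y := hmin hy
  have hpos : 0 < ε * |x - y| := mul_pos hε (abs_pos.2 (sub_ne_zero.2 hyx.symm))
  linarith
end

section
/- Let f : ℝ → ℝ be continuous on [0,1] and let ε > 0. Then there exists x* ∈ [0,1] such that for every y ∈ [0,1] with y ≠ x*, f x* < f y + ε · |x* − y|. -/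
/-- Ekeland's weak variational principle for total continuous potentials on the
unit interval. -/
theorem ekeland_unit_interval_continuous (f : ℝ → ℝ)
    (hf : ContinuousOn f (Set.Icc (0:ℝ) 1)) (ε : ℝ) (hε : 0 < ε) :
    ∃ x ∈ Set.Icc (0:ℝ) 1, ∀ y ∈ Set.Icc (0:ℝ) 1, y ≠ x →
      f x < f y + ε * |x - y| := by
  obtain ⟨x, hx, hmin⟩ :=
    isCompact_Icc.exists_isMinOn (Set.nonempty_Icc.2 zero_le_one) hf
  refine ⟨x, hx, fun y hy hne => ?_⟩
  have hle : f x ≤ f y := hmin hy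
  have hpos : 0 < ε * |x - y| := mul_pos hε (abs_pos.2 (sub_ne_zero.2 hne.symm))
  linarith
end
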